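/- Fix n ≥ 1, a vector y = (y_1,…,y_n) ∈ ℝ^n, μ ∈ ℝ, α, δ ∈ (0,1), and a real φ ≥ 0, and let w_1,…,w_n be i.i.d. Rademacher random variables with w̄_n := n^{-1} Σ_{i=1}^n w_i. If q_α(y − μ) > q_{α(1−δ)}(y − ȳ_n) + sqrt(2·log(2/(αδ))/n)·φ, then P_w( w̄_n (ȳ_n − μ) > sqrt(2·log(2/(αδ))/n)·φ ) ≥ αδ. -/

import Mathlib

open MeasureTheory ProbabilityTheory Real

/-- The Rademacher distribution on `ℝ`: `+1` and `-1` each with probability `1/2`. -/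
noncomputable def radMeasure : Measure ℝ :=
  (2⁻¹ : ENNReal) • Measure.dirac 1 + (2⁻¹ : ENNReal) • Measure.dirac (-1)

/-- The law of `n` i.i.d. Rademacher weights. -/
noncomputable def radPi (n : ℕ) : Measure (Fin n → ℝ) :=
  Measure.pi fun _ => radMeasure

/-- The Rademacher multiplier bootstrap quantile
`q_α(v) = inf {x : P_w(n⁻¹ ∑ i, w i * v i > x) ≤ α}`. -/
noncomputable def bootQuantile (n : ℕ) (v : Fin n → ℝ) (α : ℝ) : ℝ :=
  sInf {x : ℝ | radPi n {w | (∑ i, w i * v i) / n > x} ≤ ENNReal.ofReal α}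

instance : IsProbabilityMeasure radMeasure :=
  ⟨by simp [radMeasure, ENNReal.inv_two_add_inv_two]⟩

instance (n : ℕ) : IsProbabilityMeasure (radPi n) := by
  unfold radPi
  infer_instance

section UpperTail

variable {Ω : Type*} [MeasurableSpace Ω] {P : Measure Ω} {X : Ω → ℝ}

/-- Every positive level is eventually an upper bound for the upper tail of a real random
variable. -/
theorem nonempty_setOf_measure_lt_le [IsFiniteMeasure P] (hX : Measurable X) {a : ENNReal}
    (ha : 0 < a) : {x : ℝ | P {w | X w > x} ≤ a}.Nonempty := by
  have hanti : Antitone fun k : ℕ => {w | X w > (k : ℝ)} := fun i j hij w (hw : (j : ℝ) < X w) =>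
    show (i : ℝ) < X w from (Nat.cast_le.2 hij).trans_lt hw
  have hlim := tendsto_measure_iInter_atTop (μ := P)
    (fun k : ℕ => (measurableSet_lt measurable_const hX).nullMeasurableSet) hanti
    ⟨0, measure_ne_top _ _⟩
  have hempty : ⋂ k : ℕ, {w | X w > (k : ℝ)} = ∅ := by
    refine Set.eq_empty_of_forall_notMem fun w hw => ?_
    obtain ⟨k, hk⟩ := exists_nat_ge (X w)
    exact (Set.mem_iInter.1 hw k).not_ge hk
  rw [hempty, measure_empty] at hlim
  obtain ⟨k, hk⟩ := (hlim.eventually (gt_mem_nhds ha)).exists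
  exact ⟨k, hk.le⟩

/-- A level below one is exceeded by the upper tail at all sufficiently negative points. -/
theorem bddBelow_setOf_measure_lt_le [IsProbabilityMeasure P] {a : ENNReal}
    (ha : a < 1) : BddBelow {x : ℝ | P {w | X w > x} ≤ a} := by
  have hmono : Monotone fun k : ℕ => {w | X w > -(k : ℝ)} := fun i j hij w
      (hw : -(i : ℝ) < X w) =>
    show -(j : ℝ) < X w from (neg_le_neg (Nat.cast_le.2 hij)).trans_lt hw
  have hlim := tendsto_measure_iUnion_atTop (μ := P) hmono
  have huniv : ⋃ k : ℕ, {w | X w > -(k : ℝ)} = Set.univ := by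
    refine Set.eq_univ_of_forall fun w => Set.mem_iUnion.2 ?_
    obtain ⟨k, hk⟩ := exists_nat_gt (-X w)
    exact ⟨k, neg_lt.1 hk⟩
  rw [huniv, measure_univ] at hlim
  obtain ⟨k, hk⟩ := (hlim.eventually (lt_mem_nhds ha)).exists
  refine ⟨-(k : ℝ), fun x hx => ?_⟩
  by_contra! hlt
  exact (hk.trans_le (measure_mono fun w hw => hlt.trans hw)).not_ge hx

/-- The upper quantile of a real random variable is attained. -/
theorem measure_sInf_lt_le [IsFiniteMeasure P] (hX : Measurable X) {a : ENNReal}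
    (ha : 0 < a) : P {w | X w > sInf {x : ℝ | P {w | X w > x} ≤ a}} ≤ a := by
  set q := sInf {x : ℝ | P {w | X w > x} ≤ a}
  have hmono : Monotone fun k : ℕ => {w | X w > q + 1 / ((k : ℝ) + 1)} := fun i j hij w
      (hw : q + 1 / ((i : ℝ) + 1) < X w) =>
    show q + 1 / ((j : ℝ) + 1) < X w from lt_of_le_of_lt (by gcongr) hw
  have hunion : {w | X w > q} ⊆ ⋃ k : ℕ, {w | X w > q + 1 / ((k : ℝ) + 1)} := fun w hw => by
    obtain ⟨k, hk⟩ := exists_nat_one_div_lt (sub_pos.2 (show q < X w from hw))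
    exact Set.mem_iUnion.2 ⟨k, lt_sub_iff_add_lt'.1 hk⟩
  refine (measure_mono hunion).trans ?_
  rw [hmono.measure_iUnion]
  refine iSup_le fun k => ?_
  obtain ⟨x, hx, hxq⟩ := Real.lt_sInf_add_pos (nonempty_setOf_measure_lt_le (P := P) hX ha)
    (Nat.one_div_pos_of_nat (α := ℝ) (n := k))
  exact (measure_mono fun w hw => hxq.trans hw).trans hx

end UpperTail

/-- If the quantile around the true mean exceeds the corrected quantile around the empirical
mean, then the weight-average term must be large with probability at least `α·δ`. -/
theorem quantile_gap_implies_weight_deviation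
    (n : ℕ) (hn : 1 ≤ n) (y : Fin n → ℝ) (μ φ α δ : ℝ) (hφ : 0 ≤ φ)
    (hα0 : 0 < α) (hα1 : α < 1) (hδ0 : 0 < δ) (hδ1 : δ < 1)
    (h : bootQuantile n (fun i => y i - (∑ j, y j) / n) (α * (1 - δ)) +
          Real.sqrt (2 * Real.log (2 / (α * δ)) / n) * φ <
        bootQuantile n (fun i => y i - μ) α) :
    ENNReal.ofReal (α * δ) ≤
      radPi n {w | Real.sqrt (2 * Real.log (2 / (α * δ)) / n) * φ <
        ((∑ i, w i) / n) * ((∑ j, y j) / n - μ)} := by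
  have hn0 : (n : ℝ) ≠ 0 := Nat.cast_ne_zero.2 (Nat.one_le_iff_ne_zero.1 hn)
  set t := Real.sqrt (2 * Real.log (2 / (α * δ)) / n) * φ
  set m := (∑ j, y j) / n
  have hβ : 0 < α * (1 - δ) := mul_pos hα0 (sub_pos.2 hδ1)
  set q := bootQuantile n (fun i => y i - m) (α * (1 - δ))
  have hcentered : radPi n {w | (∑ i, w i * (y i - m)) / n > q} ≤
      ENNReal.ofReal (α * (1 - δ)) :=
    measure_sInf_lt_le (by fun_prop) (ENNReal.ofReal_pos.2 hβ)
  have htrue : ENNReal.ofReal α < radPi n {w | (∑ i, w i * (y i - μ)) / n > q + t} :=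
    not_le.1 fun hle => h.not_ge <|
      csInf_le (bddBelow_setOf_measure_lt_le (ENNReal.ofReal_lt_one.2 hα1)) hle
  have hdecomp (w : Fin n → ℝ) : (∑ i, w i * (y i - μ)) / n =
      (∑ i, w i * (y i - m)) / n + (∑ i, w i) / n * (m - μ) := by
    rw [div_mul_eq_mul_div, ← add_div, Finset.sum_mul, ← Finset.sum_add_distrib]
    congr 1
    exact Finset.sum_congr rfl fun i _ => by ring
  have hsub : {w : Fin n → ℝ | (∑ i, w i * (y i - μ)) / n > q + t} ⊆
      {w | (∑ i, w i * (y i - m)) / n > q} ∪ {w | t < (∑ i, w i) / n * (m - μ)} := by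
    intro w hw
    rw [Set.mem_ofPred_eq, hdecomp] at hw
    exact lt_or_lt_of_add_lt_add hw
  have hsum := (htrue.trans_le ((measure_mono hsub).trans (measure_union_le _ _))).le.trans
    (add_le_add_left hcentered _)
  have hsplit : ENNReal.ofReal α = ENNReal.ofReal (α * (1 - δ)) + ENNReal.ofReal (α * δ) := by
    rw [← ENNReal.ofReal_add hβ.le (mul_pos hα0 hδ0).le]
    congr 1
    ring
  rw [hsplit] at hsum
  exact (ENNReal.add_le_add_iff_left ENNReal.ofReal_ne_top).1 hsum
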